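/- arXiv:0706.1101 — 2 statements merged into one kernel-verified Lean document; each statement's English description precedes it below -/
import Mathlib

section
/- Let A ⊆ ℝ be a Borel set with |A| < ∞. For every ε > 0 there exists y₀ > 0 such that the following holds: for every Herglotz function F, every Borel set S ⊆ ℝ, every Borel measurable g : ℝ → [0,1] satisfying ω_{F(t+iy')}(S) → g(t) as y' → 0+ for Lebesgue-almost every t ∈ ℝ, and every 0 < y < y₀, one has |∫_A ω_{F(t+iy)}(S) dt − ∫_A g(t) dt| ≤ ε. In particular, the convergence lim_{y→0+} ∫_A ω_{F(t+iy)}(S) dt = ∫_A ω_{F(t)}(S) dt is uniform over all Herglotz functions F and all Borel sets S. -/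
open Filter Topology MeasureTheory Complex

/-- A Herglotz function: a holomorphic map of the upper half plane to itself. -/
def IsHerglotz (F : ℂ → ℂ) : Prop :=
  DifferentiableOn ℂ F {z : ℂ | 0 < z.im} ∧ ∀ z : ℂ, 0 < z.im → 0 < (F z).im

/-- Harmonic measure of a Borel set S ⊆ ℝ seen from z ∈ ℂ⁺. -/
noncomputable def harmMeas (z : ℂ) (S : Set ℝ) : ℝ :=
  (1 / Real.pi) * ∫ t in S, z.im / ((t - z.re) ^ 2 + z.im ^ 2)

lemma poissonKernel_eq_cauchyPDFReal {z : ℂ} (hz : 0 < z.im) (t : ℝ) :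
    z.im / ((t - z.re) ^ 2 + z.im ^ 2) =
      Real.pi * ProbabilityTheory.cauchyPDFReal z.re z.im.toNNReal t := by
  rw [ProbabilityTheory.cauchyPDFReal_def]
  have := Real.pi_pos
  rw [Real.coe_toNNReal _ hz.le]
  field_simp

lemma integrable_halfPlane_poissonKernel {z : ℂ} (hz : 0 < z.im) :
    Integrable fun t : ℝ => z.im / ((t - z.re) ^ 2 + z.im ^ 2) := by
  simp_rw [poissonKernel_eq_cauchyPDFReal hz]
  exact (ProbabilityTheory.integrable_cauchyPDFReal _).const_mul _

lemma harmMeas_nonneg {z : ℂ} (hz : 0 < z.im) (S : Set ℝ) : 0 ≤ harmMeas z S :=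
  mul_nonneg (by positivity) (integral_nonneg fun t => by positivity)

lemma harmMeas_le_one {z : ℂ} (hz : 0 < z.im) (S : Set ℝ) : harmMeas z S ≤ 1 := by
  have h : ∫ t in S, z.im / ((t - z.re) ^ 2 + z.im ^ 2) ≤ Real.pi := by
    refine (setIntegral_le_integral (integrable_halfPlane_poissonKernel hz)
      (Eventually.of_forall fun t => by simp only [Pi.zero_apply]; positivity)).trans_eq ?_
    simp_rw [poissonKernel_eq_cauchyPDFReal hz]
    rw [integral_const_mul, ProbabilityTheory.integral_cauchyPDFReal_eq_one, mul_one]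
    exact (Real.toNNReal_pos.2 hz).ne'
  rw [harmMeas, one_div, inv_mul_le_iff₀ Real.pi_pos, mul_one]
  exact h

lemma exists_one_add_sq_le_mul_normSq {w₀ : ℂ} (hw₀ : 0 < w₀.im) :
    ∃ C : ℝ, ∀ w ∈ Metric.ball w₀ (w₀.im / 2), ∀ t : ℝ,
      1 + t ^ 2 ≤ C * ‖(t : ℂ) - w‖ ^ 2 := by
  set b := w₀.im / 2 with hb
  set M := ‖w₀‖ + b with hM
  have hb0 : 0 < b := by positivity
  refine ⟨2 + (1 + 2 * M ^ 2) / b ^ 2, fun w hw t => ?_⟩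
  rw [Metric.mem_ball, dist_eq_norm] at hw
  have h1 : b ≤ ‖(t : ℂ) - w‖ := by
    have h2 := abs_im_le_norm ((t : ℂ) - w)
    have h3 := abs_im_le_norm (w - w₀)
    simp only [sub_im, ofReal_im, zero_sub, abs_neg] at h2 h3
    have h4 := neg_abs_le (w.im - w₀.im)
    have h5 := le_abs_self w.im
    linarith
  have h2 : ‖w‖ ≤ M := by
    have := norm_add_le (w - w₀) w₀
    rw [sub_add_cancel] at this
    linarith
  have h3 : |t| ≤ ‖(t : ℂ) - w‖ + M := by
    have := norm_add_le ((t : ℂ) - w) w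
    rw [sub_add_cancel, norm_real, Real.norm_eq_abs] at this
    linarith
  have h4 : t ^ 2 ≤ 2 * ‖(t : ℂ) - w‖ ^ 2 + 2 * M ^ 2 := by
    rw [← sq_abs t]
    have := pow_le_pow_left₀ (abs_nonneg t) h3 2
    nlinarith [sq_nonneg (‖(t : ℂ) - w‖ - M)]
  have h5 : 1 ≤ ‖(t : ℂ) - w‖ ^ 2 / b ^ 2 := by
    rw [one_le_div (by positivity)]
    exact pow_le_pow_left₀ hb0.le h1 2
  have h6 : 1 + 2 * M ^ 2 ≤ (1 + 2 * M ^ 2) * (‖(t : ℂ) - w‖ ^ 2 / b ^ 2) :=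
    le_mul_of_one_le_right (by positivity) h5
  calc 1 + t ^ 2 ≤ 2 * ‖(t : ℂ) - w‖ ^ 2 + (1 + 2 * M ^ 2) * (‖(t : ℂ) - w‖ ^ 2 / b ^ 2) := by
        linarith
    _ = _ := by ring

lemma exists_norm_inv_ofReal_sub_sq_le {w₀ : ℂ} (hw₀ : 0 < w₀.im) :
    ∃ C : ℝ, ∀ w ∈ Metric.ball w₀ (w₀.im / 2), ∀ t : ℝ,
      ‖((t : ℂ) - w)⁻¹‖ ^ 2 ≤ C * (1 + t ^ 2)⁻¹ := by
  obtain ⟨C, hC⟩ := exists_one_add_sq_le_mul_normSq hw₀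
  refine ⟨C, fun w hw t => ?_⟩
  have h := hC w hw t
  have h0 : 0 < 1 + t ^ 2 := by positivity
  have h1 : 0 < ‖(t : ℂ) - w‖ ^ 2 := by
    refine (sq_nonneg _).lt_of_ne fun h' => ?_
    rw [← h', mul_zero] at h
    linarith
  rw [norm_inv, inv_pow, ← div_eq_mul_inv, le_div_iff₀ h0, inv_mul_le_iff₀ h1, mul_comm]
  exact h

lemma ofReal_sub_ne_zero {w : ℂ} (hw : 0 < w.im) (t : ℝ) : (t : ℂ) - w ≠ 0 := by
  intro h
  have := congrArg im h
  simp at this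
  linarith

lemma continuous_inv_ofReal_sub {w : ℂ} (hw : 0 < w.im) :
    Continuous fun t : ℝ => ((t : ℂ) - w)⁻¹ :=
  (continuous_ofReal.sub continuous_const).inv₀ (ofReal_sub_ne_zero hw)

lemma integrable_inv_ofReal_sub_sub_inv_ofReal_sub {w v : ℂ} (hw : 0 < w.im) (hv : 0 < v.im) :
    Integrable fun t : ℝ => ((t : ℂ) - w)⁻¹ - ((t : ℂ) - v)⁻¹ := by
  obtain ⟨C, hC⟩ := exists_norm_inv_ofReal_sub_sq_le hw
  obtain ⟨D, hD⟩ := exists_norm_inv_ofReal_sub_sq_le hv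
  refine Integrable.mono' (integrable_inv_one_add_sq.const_mul (‖w - v‖ * (C + D)))
    ((continuous_inv_ofReal_sub hw).sub (continuous_inv_ofReal_sub hv)).aestronglyMeasurable
    (Eventually.of_forall fun t => ?_)
  have h1 := hC w (Metric.mem_ball_self (by positivity)) t
  have h2 := hD v (Metric.mem_ball_self (by positivity)) t
  have h3 : ((t : ℂ) - w)⁻¹ - ((t : ℂ) - v)⁻¹ =
      (w - v) * (((t : ℂ) - w)⁻¹ * ((t : ℂ) - v)⁻¹) := by
    have := ofReal_sub_ne_zero hw t
    have := ofReal_sub_ne_zero hv t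
    field_simp
    ring
  rw [h3, norm_mul, norm_mul, mul_assoc]
  refine mul_le_mul_of_nonneg_left ?_ (norm_nonneg _)
  nlinarith [sq_nonneg (‖((t : ℂ) - w)⁻¹‖ - ‖((t : ℂ) - v)⁻¹‖), sq_nonneg (‖((t : ℂ) - w)⁻¹‖),
    sq_nonneg (‖((t : ℂ) - v)⁻¹‖)]

lemma differentiableOn_setIntegral_inv_ofReal_sub (S : Set ℝ) {v : ℂ} (hv : 0 < v.im) :
    DifferentiableOn ℂ (fun w => ∫ t in S, (((t : ℝ) : ℂ) - w)⁻¹ - ((t : ℂ) - v)⁻¹)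
      {z : ℂ | 0 < z.im} := by
  intro w₀ hw₀
  have hw₀ : 0 < w₀.im := hw₀
  obtain ⟨C, hC⟩ := exists_norm_inv_ofReal_sub_sq_le hw₀
  have him : ∀ w ∈ Metric.ball w₀ (w₀.im / 2), 0 < w.im := by
    intro w hw
    rw [Metric.mem_ball, dist_eq_norm] at hw
    have h3 := abs_im_le_norm (w - w₀)
    rw [sub_im] at h3
    have h4 := neg_abs_le (w.im - w₀.im)
    linarith
  have hball : Metric.ball w₀ (w₀.im / 2) ∈ 𝓝 w₀ := Metric.ball_mem_nhds _ (by positivity)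
  refine (hasDerivAt_integral_of_dominated_loc_of_deriv_le
    (F := fun w (t : ℝ) => ((t : ℂ) - w)⁻¹ - ((t : ℂ) - v)⁻¹)
    (μ := volume.restrict S) (F' := fun w (t : ℝ) => (((t : ℂ) - w)⁻¹) ^ 2) (bound := fun t => C * (1 + t ^ 2)⁻¹)
    hball ?_ (integrable_inv_ofReal_sub_sub_inv_ofReal_sub hw₀ hv).integrableOn
    ((continuous_inv_ofReal_sub hw₀).pow 2).aestronglyMeasurable
    (Eventually.of_forall fun t w hw => ?_) (integrable_inv_one_add_sq.const_mul C).integrableOn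
    (Eventually.of_forall fun t w hw => ?_)).2.differentiableAt.differentiableWithinAt
  · filter_upwards [hball] with w hw
    exact ((continuous_inv_ofReal_sub (him w hw)).sub
      (continuous_inv_ofReal_sub hv)).aestronglyMeasurable
  · rw [norm_pow]
    exact hC w hw t
  · have h := (((hasDerivAt_id w).const_sub (t : ℂ)).inv
      (ofReal_sub_ne_zero (him w hw) t)).sub_const ((t : ℂ) - v)⁻¹
    refine h.congr_deriv ?_
    rw [neg_neg, one_div, inv_pow, id]

lemma im_inv_ofReal_sub (w : ℂ) (t : ℝ) :
    (((t : ℂ) - w)⁻¹).im = w.im / ((t - w.re) ^ 2 + w.im ^ 2) := by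
  rw [inv_im, normSq_apply]
  simp
  ring_nf

lemma exists_differentiableOn_im_eq_harmMeas (S : Set ℝ) :
    ∃ H : ℂ → ℂ, DifferentiableOn ℂ H {z : ℂ | 0 < z.im} ∧
      ∀ z : ℂ, 0 < z.im → (H z).im = harmMeas z S := by
  have hI : 0 < I.im := by simp
  refine ⟨fun w => ((1 / Real.pi : ℝ) : ℂ) * (∫ t in S, (((t : ℝ) : ℂ) - w)⁻¹ - ((t : ℂ) - I)⁻¹)
    + (harmMeas I S : ℂ) * I,
    ((differentiableOn_setIntegral_inv_ofReal_sub S hI).const_mul _).add_const _, fun z hz => ?_⟩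
  have h : (∫ t in S, (((t : ℝ) : ℂ) - z)⁻¹ - ((t : ℂ) - I)⁻¹).im =
      (∫ t in S, z.im / ((t - z.re) ^ 2 + z.im ^ 2)) -
        ∫ t in S, I.im / ((t - I.re) ^ 2 + I.im ^ 2) := by
    rw [← integral_sub (integrable_halfPlane_poissonKernel hz).integrableOn
      (integrable_halfPlane_poissonKernel hI).integrableOn]
    refine (integral_im (integrable_inv_ofReal_sub_sub_inv_ofReal_sub hz hI).integrableOn).symm.trans
      (integral_congr_ae (Eventually.of_forall fun t => ?_))
    simp only [← im_inv_ofReal_sub]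
    exact sub_im _ _
  rw [add_im, im_ofReal_mul, h, im_ofReal_mul, I_im, mul_one, harmMeas, harmMeas, I_im]
  ring

lemma I_mul_one_sub_div_one_add_exp {θ : ℝ} (hθ : Real.cos (θ / 2) ≠ 0) :
    1 + exp (θ * I) ≠ 0 ∧
    I * ((1 - exp (θ * I)) / (1 + exp (θ * I))) = (Real.tan (θ / 2) : ℂ) := by
  set c : ℂ := Complex.cos ((θ / 2 : ℝ) : ℂ) with hc
  set s : ℂ := Complex.sin ((θ / 2 : ℝ) : ℂ) with hs
  have h0 : c ≠ 0 := by rw [hc, ← ofReal_cos]; exact_mod_cast hθ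
  have h1 : exp (θ * I) = (c + s * I) ^ 2 := by
    rw [hc, hs, ← exp_mul_I, ← exp_nat_mul]
    congr 1
    push_cast
    ring
  have h2 : s ^ 2 + c ^ 2 = 1 := Complex.sin_sq_add_cos_sq _
  have h3 : c + s * I ≠ 0 := by
    rw [hc, hs, ← exp_mul_I]
    exact exp_ne_zero _
  have h4 : 1 + exp (θ * I) = 2 * c * (c + s * I) := by
    rw [h1]
    linear_combination (-1 : ℂ) * h2 + s ^ 2 * I_sq
  have h5 : 1 - exp (θ * I) = -2 * I * s * (c + s * I) := by
    rw [h1]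
    linear_combination (-1 : ℂ) * h2 + s ^ 2 * I_sq
  refine ⟨by rw [h4]; exact mul_ne_zero (mul_ne_zero two_ne_zero h0) h3, ?_⟩
  rw [h4, h5, mul_div_mul_right _ _ h3, ofReal_tan, Complex.tan_eq_sin_div_cos, ← hc, ← hs]
  field_simp
  linear_combination -s * I_sq

lemma one_add_ne_zero_of_norm_lt_one {w : ℂ} (hw : ‖w‖ < 1) : 1 + w ≠ 0 := by
  intro h
  rw [show w = -1 by linear_combination h] at hw
  simp at hw

lemma re_one_sub_div_one_add_pos {w : ℂ} (hw : ‖w‖ < 1) : 0 < ((1 - w) / (1 + w)).re := by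
  have h1 : w.re * w.re + w.im * w.im < 1 := by
    rw [← normSq_apply, normSq_eq_norm_sq]
    exact pow_lt_one₀ (norm_nonneg _) hw two_ne_zero
  have h2 : 0 < normSq (1 + w) := normSq_pos.2 (one_add_ne_zero_of_norm_lt_one hw)
  rw [div_re, ← add_div]
  refine div_pos ?_ h2
  simp
  nlinarith

theorem im_eq_integral_tan_of_differentiableOn {h : ℂ → ℂ}
    (hd : DifferentiableOn ℂ h {z : ℂ | 0 < z.im}) {K : ℝ}
    (hb : ∀ z : ℂ, 0 < z.im → |(h z).im| ≤ K)
    {s y : ℝ} (hs : 0 < s) (hy : 0 < y) (x : ℝ) :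
    (h (x + (s + y : ℝ) * I)).im =
      (2 * Real.pi)⁻¹ *
        ∫ θ in (0)..(2 * Real.pi), (h ((x + y * Real.tan (θ / 2) : ℝ) + s * I)).im := by
  set φ : ℂ → ℂ := fun w => s * I + x + y * (I * ((1 - w) / (1 + w))) with hφ
  have hφ_im : ∀ w : ℂ, ‖w‖ < 1 → 0 < (φ w).im := by
    intro w hw
    have := re_one_sub_div_one_add_pos hw
    have h2 : (φ w).im = s + y * ((1 - w) / (1 + w)).re := by
      simp only [hφ, add_im, im_ofReal_mul, I_mul_im, I_im, ofReal_im]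
      ring
    rw [h2]
    positivity
  have hφ_diff : ∀ w : ℂ, 1 + w ≠ 0 → DifferentiableAt ℂ φ w := by
    intro w hw
    fun_prop (disch := assumption)
  have hU : IsOpen {z : ℂ | 0 < z.im} := isOpen_lt continuous_const continuous_im
  have hg : ∀ w : ℂ, 0 < (φ w).im → 1 + w ≠ 0 → DifferentiableAt ℂ (h ∘ φ) w := fun w hw hw' =>
    (hd.differentiableAt (hU.mem_nhds hw)).comp w (hφ_diff w hw')
  have hg' : ∀ w : ℂ, ‖w‖ < 1 → DifferentiableAt ℂ (h ∘ φ) w := fun w hw =>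
    hg w (hφ_im w hw) (one_add_ne_zero_of_norm_lt_one hw)
  have hmean : ∀ r : ℝ, r ∈ Set.Ioo (0 : ℝ) 1 →
      (2 * Real.pi)⁻¹ * ∫ θ in (0)..(2 * Real.pi), (h (φ (circleMap 0 r θ))).im =
        (h (x + (s + y : ℝ) * I)).im := by
    intro r hr
    have hcl : DifferentiableOn ℂ (h ∘ φ) (Metric.closedBall 0 r) := fun w hw =>
      (hg' w ((mem_closedBall_zero_iff.1 hw).trans_lt hr.2)).differentiableWithinAt
    have hav : Real.circleAverage (h ∘ φ) 0 r = (h ∘ φ) 0 := by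
      refine DiffContOnCl.circleAverage ?_
      rw [abs_of_pos hr.1]
      exact hcl.diffContOnCl_ball subset_rfl
    have hint : CircleIntegrable (h ∘ φ) 0 r :=
      (hcl.continuousOn.mono Metric.sphere_subset_closedBall).circleIntegrable hr.1.le
    have := imCLM.circleAverage_comp_comm hint
    rw [hav, Real.circleAverage_def, smul_eq_mul] at this
    simp only [Function.comp_apply, imCLM_apply] at this
    rw [this]
    congr 2
    simp only [hφ]
    push_cast
    ring
  have hlim : Tendsto (fun r : ℝ => (2 * Real.pi)⁻¹ *
      ∫ θ in (0)..(2 * Real.pi), (h (φ (circleMap 0 r θ))).im) (𝓝[<] 1)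
      (𝓝 ((2 * Real.pi)⁻¹ *
        ∫ θ in (0)..(2 * Real.pi), (h ((x + y * Real.tan (θ / 2) : ℝ) + s * I)).im)) := by
    have hev : ∀ᶠ r : ℝ in 𝓝[<] 1, r ∈ Set.Ioo (0 : ℝ) 1 := Ioo_mem_nhdsLT one_pos
    have hnorm : ∀ r ∈ Set.Ioo (0 : ℝ) 1, ∀ θ, ‖circleMap 0 r θ‖ < 1 := by
      intro r hr θ
      rw [norm_circleMap_zero, abs_of_pos hr.1]
      exact hr.2
    refine (intervalIntegral.tendsto_integral_filter_of_dominated_convergence (fun _ => K)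
      ?_ ?_ intervalIntegrable_const ?_).const_mul _
    · filter_upwards [hev] with r hr
      refine (continuous_im.comp (continuous_iff_continuousAt.2 fun θ => ?_)).aestronglyMeasurable
      exact ContinuousAt.comp (f := circleMap 0 r) (g := h ∘ φ)
        (hg' _ (hnorm r hr θ)).continuousAt (continuous_circleMap 0 r).continuousAt
    · filter_upwards [hev] with r hr
      exact Eventually.of_forall fun θ _ => hb _ (hφ_im _ (hnorm r hr θ))
    · have hne : ∀ᵐ θ : ℝ, θ ≠ Real.pi := by simp [ae_iff, measure_singleton]
      filter_upwards [hne] with θ hθ hmem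
      rw [Set.uIoc_of_le Real.two_pi_pos.le] at hmem
      have hcos : Real.cos (θ / 2) ≠ 0 := by
        rcases hθ.lt_or_gt with hlt | hgt
        · exact (Real.cos_pos_of_mem_Ioo ⟨by linarith [hmem.1, Real.pi_pos], by linarith⟩).ne'
        · exact (Real.cos_neg_of_pi_div_two_lt_of_lt (by linarith)
            (by linarith [hmem.2, Real.pi_pos])).ne
      obtain ⟨hne', htan⟩ := I_mul_one_sub_div_one_add_exp hcos
      have hval : φ (exp (θ * I)) = (x + y * Real.tan (θ / 2) : ℝ) + s * I := by
        simp only [hφ, htan]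
        push_cast
        ring
      have him : 0 < (φ (exp (θ * I))).im := by
        rw [hval, add_im, ofReal_im, zero_add, im_ofReal_mul, I_im, mul_one]
        exact hs
      have hcm : Tendsto (fun r : ℝ => circleMap 0 r θ) (𝓝[<] 1) (𝓝 (exp (θ * I))) := by
        have : Continuous fun r : ℝ => circleMap 0 r θ := by
          unfold circleMap
          fun_prop
        have h1 := this.tendsto 1
        simp only [circleMap, ofReal_one, one_mul, zero_add] at h1 ⊢
        exact h1.mono_left nhdsWithin_le_nhds
      have := (continuous_im.tendsto _).comp (((hg _ him hne').continuousAt.tendsto).comp hcm)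
      rw [Function.comp_apply, hval] at this
      exact this
  refine tendsto_nhds_unique (Tendsto.congr' ?_ tendsto_const_nhds) hlim
  filter_upwards [Ioo_mem_nhdsLT (one_pos : (0 : ℝ) < 1)] with r hr
  exact (hmean r hr).symm

open scoped symmDiff

lemma tendsto_measureReal_symmDiff_preimage_sub {A : Set ℝ} (hA : MeasurableSet A)
    (hAfin : volume A < ⊤) :
    Tendsto (fun τ : ℝ => volume.real (((fun t => t - τ) ⁻¹' A) ∆ A)) (𝓝 0) (𝓝 0) := by
  let f : C(ℝ, C(ℝ, ℝ)) := ContinuousMap.curry ⟨fun p : ℝ × ℝ => p.2 - p.1, by fun_prop⟩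
  have h := tendsto_measure_symmDiff_preimage_nhds_zero (μ := volume) (ν := volume)
    (f := f) (g := f 0) (s := A) (f.continuous.tendsto 0)
    (Eventually.of_forall fun τ => measurePreserving_sub_right volume τ)
    (measurePreserving_sub_right volume 0) hA.nullMeasurableSet hAfin.ne
  have h0 : f 0 ⁻¹' A = A := by
    ext t
    simp [f]
  rw [h0] at h
  exact (ENNReal.tendsto_toReal ENNReal.zero_ne_top).comp h

lemma measurable_measureReal_symmDiff_preimage_sub {A : Set ℝ} (hA : MeasurableSet A) :
    Measurable (fun τ : ℝ => volume.real (((fun t => t - τ) ⁻¹' A) ∆ A)) := by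
  have h1 : MeasurableSet {p : ℝ × ℝ | p.2 - p.1 ∈ A} :=
    (measurable_snd.sub measurable_fst) hA
  have h2 : MeasurableSet {p : ℝ × ℝ | p.2 ∈ A} := measurable_snd hA
  exact (measurable_measure_prodMk_left (ν := (volume : Measure ℝ)) (h1.symmDiff h2)).ennreal_toReal

lemma measureReal_symmDiff_preimage_sub_le {A : Set ℝ} (hA : MeasurableSet A)
    (hAfin : volume A < ⊤) (τ : ℝ) :
    volume.real (((fun t => t - τ) ⁻¹' A) ∆ A) ≤ 2 * volume.real A := by
  have h := (measurePreserving_sub_right volume τ).measure_preimage hA.nullMeasurableSet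
  have h1 : volume.real ((fun t => t - τ) ⁻¹' A) = volume.real A := congrArg ENNReal.toReal h
  calc volume.real (((fun t => t - τ) ⁻¹' A) ∆ A)
      ≤ volume.real (((fun t => t - τ) ⁻¹' A) ∪ A) :=
        measureReal_mono (symmDiff_le_sup (a := (fun t => t - τ) ⁻¹' A) (b := A))
          (measure_union_lt_top (h.trans_lt hAfin) hAfin).ne
    _ ≤ volume.real ((fun t => t - τ) ⁻¹' A) + volume.real A := measureReal_union_le _ _
    _ = 2 * volume.real A := by rw [h1]; ring

lemma abs_setIntegral_sub_setIntegral_le {α : Type*} [MeasurableSpace α] {μ : Measure α}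
    {v : α → ℝ} (hv : Measurable v) (hv01 : ∀ t, v t ∈ Set.Icc (0 : ℝ) 1) {A B : Set α}
    (hA : MeasurableSet A) (hB : MeasurableSet B) (hAfin : μ A < ⊤) (hBfin : μ B < ⊤) :
    |(∫ t in B, v t ∂μ) - ∫ t in A, v t ∂μ| ≤ μ.real (B ∆ A) := by
  have hint : ∀ s : Set α, μ s < ⊤ → IntegrableOn v s μ := fun s hs =>
    Measure.integrableOn_of_bounded (M := 1) hs.ne hv.aestronglyMeasurable
      (Eventually.of_forall fun t => by
        rw [Real.norm_eq_abs, abs_of_nonneg (hv01 t).1]; exact (hv01 t).2)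
  have hbd : ∀ s : Set α, μ s < ⊤ → 0 ≤ ∫ t in s, v t ∂μ ∧ ∫ t in s, v t ∂μ ≤ μ.real s := by
    intro s hs
    refine ⟨integral_nonneg fun t => (hv01 t).1, ?_⟩
    have := integral_mono (hint s hs) (integrableOn_const hs.ne (C := (1 : ℝ)))
      fun t => (hv01 t).2
    simpa using this
  have h1 := integral_inter_add_sdiff hA (hint B hBfin)
  have h2 := integral_inter_add_sdiff hB (hint A hAfin)
  have hBA : μ (B \ A) < ⊤ := (measure_mono Set.sdiff_subset).trans_lt hBfin
  have hAB : μ (A \ B) < ⊤ := (measure_mono Set.sdiff_subset).trans_lt hAfin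
  have h3 : μ.real (B ∆ A) = μ.real (B \ A) + μ.real (A \ B) :=
    measureReal_union disjoint_sdiff_sdiff (hA.diff hB) hBA.ne hAB.ne
  rw [Set.inter_comm] at h2
  have h4 := hbd _ hBA
  have h5 := hbd _ hAB
  rw [h3, abs_le]
  constructor <;> linarith [h4.1, h4.2, h5.1, h5.2]

lemma abs_setIntegral_comp_add_sub_setIntegral_le {v : ℝ → ℝ} (hv : Measurable v)
    (hv01 : ∀ t, v t ∈ Set.Icc (0 : ℝ) 1) {A : Set ℝ} (hA : MeasurableSet A)
    (hAfin : volume A < ⊤) (τ : ℝ) :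
    |(∫ t in A, v (t + τ)) - ∫ t in A, v t| ≤ volume.real (((fun t => t - τ) ⁻¹' A) ∆ A) := by
  have hpre : (fun t => t + τ) ⁻¹' ((fun t => t - τ) ⁻¹' A) = A := by
    ext t
    simp
  have h := (measurePreserving_add_right volume τ).setIntegral_preimage_emb
    (measurableEmbedding_addRight τ) v ((fun t => t - τ) ⁻¹' A)
  rw [hpre] at h
  rw [h]
  refine abs_setIntegral_sub_setIntegral_le hv hv01 hA ((measurable_id.sub_const τ) hA) hAfin ?_
  exact ((measurePreserving_sub_right volume τ).measure_preimage hA.nullMeasurableSet).trans_lt hAfin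

/-- The average of `|(A + τ) ∆ A|` over `τ = y tan (θ / 2)` with `θ` uniform in `(0, 2π)`, that is,
over a Cauchy distributed `τ` of scale `y`. -/
noncomputable def cauchyTranslationModulus (A : Set ℝ) (y : ℝ) : ℝ :=
  (2 * Real.pi)⁻¹ * ∫ θ in (0)..(2 * Real.pi),
    volume.real (((fun t => t - y * Real.tan (θ / 2)) ⁻¹' A) ∆ A)

lemma measurable_tan_div_two : Measurable fun θ : ℝ => Real.tan (θ / 2) := by
  simp_rw [Real.tan_eq_sin_div_cos]
  fun_prop

lemma tendsto_cauchyTranslationModulus {A : Set ℝ} (hA : MeasurableSet A)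
    (hAfin : volume A < ⊤) : Tendsto (cauchyTranslationModulus A) (𝓝 0) (𝓝 0) := by
  have h : Tendsto (cauchyTranslationModulus A) (𝓝 0)
      (𝓝 ((2 * Real.pi)⁻¹ * ∫ θ in (0)..(2 * Real.pi), (0 : ℝ))) := by
    refine (intervalIntegral.tendsto_integral_filter_of_dominated_convergence
      (fun _ => 2 * volume.real A) ?_ ?_ intervalIntegrable_const ?_).const_mul _
    · exact Eventually.of_forall fun y => ((measurable_measureReal_symmDiff_preimage_sub hA).comp
        (measurable_tan_div_two.const_mul y)).aestronglyMeasurable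
    · refine Eventually.of_forall fun y => Eventually.of_forall fun θ _ => ?_
      rw [Real.norm_eq_abs, abs_of_nonneg measureReal_nonneg]
      exact measureReal_symmDiff_preimage_sub_le hA hAfin _
    · refine Eventually.of_forall fun θ _ => ?_
      refine (tendsto_measureReal_symmDiff_preimage_sub hA hAfin).comp ?_
      have : Continuous fun y : ℝ => y * Real.tan (θ / 2) := by fun_prop
      simpa using this.tendsto 0
  simpa using h

lemma abs_setIntegral_tan_average_sub_le {v : ℝ → ℝ} (hv : Measurable v)
    (hv01 : ∀ t, v t ∈ Set.Icc (0 : ℝ) 1) {A : Set ℝ} (hA : MeasurableSet A)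
    (hAfin : volume A < ⊤) (y : ℝ) :
    |(∫ t in A, (2 * Real.pi)⁻¹ * ∫ θ in (0)..(2 * Real.pi), v (t + y * Real.tan (θ / 2))) -
      ∫ t in A, v t| ≤ cauchyTranslationModulus A y := by
  have : IsFiniteMeasure (volume.restrict A) := ⟨by simpa using hAfin⟩
  have hnorm : ∀ t, ‖v t‖ ≤ 1 := fun t => by
    rw [Real.norm_eq_abs, abs_of_nonneg (hv01 t).1]; exact (hv01 t).2
  have hint : Integrable (Function.uncurry fun t θ : ℝ => v (t + y * Real.tan (θ / 2)))
      ((volume.restrict A).prod (volume.restrict (Set.Ioc 0 (2 * Real.pi)))) := by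
    refine Integrable.of_bound ?_ 1 (Eventually.of_forall fun p => hnorm _)
    exact (hv.comp (measurable_fst.add ((measurable_tan_div_two.const_mul y).comp
      measurable_snd))).aestronglyMeasurable
  have hpi := Real.pi_pos
  have h2pi : (0 : ℝ) ≤ 2 * Real.pi := by positivity
  have hconst : ∫ t in A, v t =
      (2 * Real.pi)⁻¹ * ∫ θ in Set.Ioc 0 (2 * Real.pi), ∫ t in A, v t := by
    simp [h2pi]
    field_simp
  rw [integral_const_mul, cauchyTranslationModulus]
  simp_rw [intervalIntegral.integral_of_le h2pi]
  rw [integral_integral_swap hint, hconst, ← mul_sub, abs_mul, abs_of_pos (by positivity)]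
  refine mul_le_mul_of_nonneg_left ?_ (by positivity)
  have hswap : Integrable (fun θ => ∫ t in A, v (t + y * Real.tan (θ / 2)))
      (volume.restrict (Set.Ioc 0 (2 * Real.pi))) := hint.integral_prod_right
  rw [← integral_sub hswap (integrable_const _)]
  refine abs_integral_le_integral_abs.trans (integral_mono_of_nonneg
    (Eventually.of_forall fun θ => abs_nonneg _) ?_ (Eventually.of_forall fun θ =>
      abs_setIntegral_comp_add_sub_setIntegral_le hv hv01 hA hAfin _))
  refine Integrable.of_bound ((measurable_measureReal_symmDiff_preimage_sub hA).comp
        (measurable_tan_div_two.const_mul y)).aestronglyMeasurable (2 * volume.real A)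
        (Eventually.of_forall fun θ => ?_)
  rw [Real.norm_eq_abs, abs_of_nonneg measureReal_nonneg]
  exact measureReal_symmDiff_preimage_sub_le hA hAfin _

/-- The quantitative form: before passing to the boundary, moving up by `y` changes the integral over
`A` by at most the averaged translation modulus. -/
lemma abs_setIntegral_harmMeas_add_sub_le {F : ℂ → ℂ} (hF : IsHerglotz F) (S : Set ℝ) {A : Set ℝ}
    (hA : MeasurableSet A) (hAfin : volume A < ⊤) {s y : ℝ} (hs : 0 < s) (hy : 0 < y) :
    |(∫ t in A, harmMeas (F (t + (s + y : ℝ) * I)) S) - ∫ t in A, harmMeas (F (t + s * I)) S| ≤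
      cauchyTranslationModulus A y := by
  obtain ⟨H, hH, hHim⟩ := exists_differentiableOn_im_eq_harmMeas S
  have hd : DifferentiableOn ℂ (H ∘ F) {z : ℂ | 0 < z.im} := hH.comp hF.1 hF.2
  have him : ∀ z : ℂ, 0 < z.im → ((H ∘ F) z).im = harmMeas (F z) S :=
    fun z hz => hHim _ (hF.2 z hz)
  have hline : ∀ (t : ℝ) {r : ℝ}, 0 < r → 0 < ((t : ℂ) + r * I).im := by
    intro t r hr
    simpa using hr
  have hb : ∀ z : ℂ, 0 < z.im → |((H ∘ F) z).im| ≤ 1 := by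
    intro z hz
    rw [him z hz, abs_of_nonneg (harmMeas_nonneg (hF.2 z hz) S)]
    exact harmMeas_le_one (hF.2 z hz) S
  have hcont : Continuous fun t : ℝ => harmMeas (F (t + s * I)) S := by
    have : Continuous fun t : ℝ => ((H ∘ F) (t + s * I)).im :=
      continuous_im.comp (hd.continuousOn.comp_continuous (by fun_prop) fun t => hline t hs)
    exact this.congr fun t => him _ (hline t hs)
  have h := abs_setIntegral_tan_average_sub_le hcont.measurable
    (fun t => ⟨harmMeas_nonneg (hF.2 _ (hline t hs)) S, harmMeas_le_one (hF.2 _ (hline t hs)) S⟩)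
    hA hAfin y
  convert h using 3
  refine integral_congr_ae (Eventually.of_forall fun t => ?_)
  simp only
  rw [← him _ (hline t (add_pos hs hy)), im_eq_integral_tan_of_differentiableOn hd hb hs hy]
  congr 2
  funext θ
  exact him _ (hline _ hs)

/-- Integrals over a set of finite measure of harmonic measure along horizontal lines converge if
the integrand does so almost everywhere. -/
lemma tendsto_setIntegral_harmMeas {F : ℂ → ℂ} (hF : IsHerglotz F) (S : Set ℝ) {A : Set ℝ}
    (hAfin : volume A < ⊤) {y : ℝ} (hy : 0 ≤ y) {g : ℝ → ℝ}
    (hg : ∀ᵐ t : ℝ, Tendsto (fun s : ℝ => harmMeas (F (t + (s + y : ℝ) * I)) S)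
      (𝓝[>] 0) (𝓝 (g t))) :
    Tendsto (fun s : ℝ => ∫ t in A, harmMeas (F (t + (s + y : ℝ) * I)) S) (𝓝[>] 0)
      (𝓝 (∫ t in A, g t)) := by
  have : IsFiniteMeasure (volume.restrict A) := ⟨by simpa using hAfin⟩
  obtain ⟨H, hH, hHim⟩ := exists_differentiableOn_im_eq_harmMeas S
  have hline : ∀ (t : ℝ) {s : ℝ}, 0 < s → 0 < ((t : ℂ) + (s + y : ℝ) * I).im := by
    intro t s hs
    rw [add_im, ofReal_im, zero_add, im_ofReal_mul, I_im, mul_one]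
    positivity
  refine tendsto_integral_filter_of_dominated_convergence (fun _ => 1) ?_ ?_
    (integrable_const _) (ae_restrict_of_ae hg)
  · filter_upwards [self_mem_nhdsWithin] with s hs
    have hc : Continuous fun t : ℝ => ((H ∘ F) (t + (s + y : ℝ) * I)).im :=
      continuous_im.comp ((hH.comp hF.1 hF.2).continuousOn.comp_continuous (by fun_prop)
        fun t => hline t hs)
    exact (hc.congr fun t => hHim _ (hF.2 _ (hline t hs))).aestronglyMeasurable
  · filter_upwards [self_mem_nhdsWithin] with s hs
    refine Eventually.of_forall fun t => ?_
    have hpos := hF.2 _ (hline t hs)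
    rw [Real.norm_eq_abs, abs_of_nonneg (harmMeas_nonneg hpos S)]
    exact harmMeas_le_one hpos S

lemma tendsto_harmMeas_add {F : ℂ → ℂ} (hF : IsHerglotz F) (S : Set ℝ) {y : ℝ} (hy : 0 < y)
    (t : ℝ) :
    Tendsto (fun s : ℝ => harmMeas (F (t + (s + y : ℝ) * I)) S) (𝓝[>] 0)
      (𝓝 (harmMeas (F (t + y * I)) S)) := by
  obtain ⟨H, hH, hHim⟩ := exists_differentiableOn_im_eq_harmMeas S
  have hU : IsOpen {z : ℂ | 0 < z.im} := isOpen_lt continuous_const continuous_im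
  have hpos : 0 < ((t : ℂ) + y * I).im := by simpa using hy
  have h1 : Tendsto (fun s : ℝ => (t : ℂ) + (s + y : ℝ) * I) (𝓝[>] 0) (𝓝 (t + y * I)) := by
    have : Continuous fun s : ℝ => (t : ℂ) + (s + y : ℝ) * I := by fun_prop
    have := this.tendsto 0
    rw [zero_add] at this
    exact this.mono_left nhdsWithin_le_nhds
  have h2 : ContinuousAt (H ∘ F) (t + y * I) :=
    (hH.comp hF.1 hF.2).continuousOn.continuousAt (hU.mem_nhds hpos)
  have h3 := (continuous_im.tendsto _).comp (h2.tendsto.comp h1)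
  rw [Function.comp_apply, hHim _ (hF.2 _ hpos)] at h3
  refine h3.congr' ?_
  filter_upwards [h1.eventually (hU.mem_nhds hpos)] with s hs
  exact hHim _ (hF.2 _ hs)

theorem stmt15 (A : Set ℝ) (hA : MeasurableSet A) (hAfin : MeasureTheory.volume A < ⊤) :
    ∀ ε : ℝ, 0 < ε → ∃ y₀ : ℝ, 0 < y₀ ∧
      ∀ F : ℂ → ℂ, IsHerglotz F → ∀ S : Set ℝ, MeasurableSet S →
        ∀ g : ℝ → ℝ, Measurable g → (∀ t, g t ∈ Set.Icc (0 : ℝ) 1) →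
          (∀ᵐ t : ℝ, Tendsto (fun y' : ℝ => harmMeas (F (t + y' * Complex.I)) S)
            (𝓝[>] 0) (𝓝 (g t))) →
          ∀ y : ℝ, 0 < y → y < y₀ →
            |(∫ t in A, harmMeas (F (t + y * Complex.I)) S) - ∫ t in A, g t| ≤ ε := by
  intro ε hε
  have hsmall : ∀ᶠ y in 𝓝 (0 : ℝ), cauchyTranslationModulus A y < ε :=
    (tendsto_cauchyTranslationModulus hA hAfin).eventually (gt_mem_nhds hε)
  obtain ⟨y₀, hy₀, hlt⟩ := Metric.eventually_nhds_iff.1 hsmall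
  refine ⟨y₀, hy₀, fun F hF S _ g _ _ hlim y hy hyy₀ => ?_⟩
  have hle : cauchyTranslationModulus A y ≤ ε :=
    (hlt (by rwa [Real.dist_eq, sub_zero, abs_of_pos hy])).le
  have h1 := tendsto_setIntegral_harmMeas hF S hAfin hy.le
    (Eventually.of_forall fun t => tendsto_harmMeas_add hF S hy t)
  have h2 := tendsto_setIntegral_harmMeas hF S hAfin le_rfl (g := g) (by simpa using hlim)
  simp only [add_zero] at h2
  refine le_of_tendsto (h1.sub h2).abs ?_
  filter_upwards [self_mem_nhdsWithin] with s hs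
  exact (abs_setIntegral_harmMeas_add_sub_le hF S hA hAfin hs hy).trans hle
end

section
/- Let A ⊆ ℝ be a Borel set with |A| < ∞, let y > 0, and let g : ℝ → [0,1] be Borel measurable. Then |∫_ℝ ω_{u+iy}(A) g(u) du − ∫_A g(u) du| ≤ ∫_A ω_{t+iy}(ℝ∖A) dt. -/
open Filter Topology MeasureTheory Complex

open ProbabilityTheory in
/-- The harmonic measure from `u + iy` has the Cauchy density with location `u` and scale `y`. -/
lemma harmMeas_eq_setIntegral_cauchyPDFReal (u : ℝ) (y : NNReal) (S : Set ℝ) :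
    harmMeas (u + y * Complex.I) S = ∫ t in S, cauchyPDFReal u y t := by
  simp only [harmMeas, cauchyPDFReal_def, ← integral_const_mul]
  refine integral_congr_ae (ae_of_all _ fun t => ?_)
  simp [div_eq_mul_inv, mul_assoc]

lemma harmMeas_nonneg_s16 (u : ℝ) {y : NNReal} (hy : y ≠ 0) (S : Set ℝ) :
    0 ≤ harmMeas (u + y * Complex.I) S := by
  rw [harmMeas_eq_setIntegral_cauchyPDFReal u y]
  exact integral_nonneg fun t => (ProbabilityTheory.cauchyPDF_pos u hy t).le

lemma harmMeas_compl (u : ℝ) {y : NNReal} (hy : y ≠ 0) {S : Set ℝ} (hS : MeasurableSet S) :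
    harmMeas (u + y * Complex.I) Sᶜ = 1 - harmMeas (u + y * Complex.I) S := by
  simp only [harmMeas_eq_setIntegral_cauchyPDFReal]
  rw [eq_sub_iff_add_eq', integral_add_compl hS (ProbabilityTheory.integrable_cauchyPDFReal u),
    ProbabilityTheory.integral_cauchyPDFReal_eq_one u hy]

open ProbabilityTheory in
lemma harmMeas_eq_convolution (y : NNReal) {S : Set ℝ} (hS : MeasurableSet S) :
    (fun u : ℝ => harmMeas (u + y * Complex.I) S) =
      convolution (S.indicator fun _ => (1 : ℝ)) (cauchyPDFReal 0 y)
        (ContinuousLinearMap.mul ℝ ℝ) volume := by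
  ext u
  rw [harmMeas_eq_setIntegral_cauchyPDFReal u y, convolution_mul, ← integral_indicator hS]
  refine integral_congr_ae (ae_of_all _ fun t => ?_)
  by_cases ht : t ∈ S
  · simp [ht, cauchyPDFReal_def, sub_sq_comm t u]
  · simp [ht]

lemma integrable_harmMeas (y : NNReal) {S : Set ℝ} (hS : MeasurableSet S)
    (hfin : volume S < ⊤) : Integrable fun u : ℝ => harmMeas (u + y * Complex.I) S := by
  rw [harmMeas_eq_convolution y hS]
  exact ((integrable_indicator_iff hS).2 (integrableOn_const hfin.ne)).integrable_convolution _
    (ProbabilityTheory.integrable_cauchyPDFReal 0)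

lemma integral_harmMeas {y : NNReal} (hy : y ≠ 0) {S : Set ℝ} (hS : MeasurableSet S)
    (hfin : volume S < ⊤) : ∫ u : ℝ, harmMeas (u + y * Complex.I) S = volume.real S := by
  rw [harmMeas_eq_convolution y hS]
  refine (integral_convolution _ ((integrable_indicator_iff hS).2 (integrableOn_const hfin.ne))
    (ProbabilityTheory.integrable_cauchyPDFReal 0)).trans ?_
  rw [ProbabilityTheory.integral_cauchyPDFReal_eq_one 0 hy, integral_indicator hS]
  simp

/-- If `h` is `[0, 1]`-valued with total mass `μ A`, then on `[0, 1]`-valued test functions `h`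
differs from the indicator of `A` by at most the mass that `h` misses on `A`. -/
lemma abs_integral_mul_sub_setIntegral_le {α : Type*} [MeasurableSpace α] {μ : Measure α}
    {A : Set α} (hA : MeasurableSet A) (hAfin : μ A < ⊤) {h g : α → ℝ} (hint : Integrable h μ)
    (h0 : ∀ u, 0 ≤ h u) (h1 : ∀ u, h u ≤ 1) (hmass : ∫ u, h u ∂μ = μ.real A)
    (hg : Measurable g) (hgbd : ∀ u, g u ∈ Set.Icc (0 : ℝ) 1) :
    |(∫ u, h u * g u ∂μ) - ∫ u in A, g u ∂μ| ≤ ∫ u in A, (1 - h u) ∂μ := by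
  have hgA : IntegrableOn g A μ := Measure.integrableOn_of_bounded (M := 1) hAfin.ne
    hg.aestronglyMeasurable (ae_of_all _ fun u => by
      rw [Real.norm_of_nonneg (hgbd u).1]; exact (hgbd u).2)
  have hhg : Integrable (fun u => h u * g u) μ := hint.mono
    (hint.aestronglyMeasurable.mul hg.aestronglyMeasurable) (ae_of_all _ fun u => by
      rw [norm_mul, Real.norm_of_nonneg (hgbd u).1]
      exact mul_le_of_le_one_right (norm_nonneg _) (hgbd u).2)
  have hone : IntegrableOn (fun _ => (1 : ℝ)) A μ := integrableOn_const hAfin.ne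
  have split := integral_add_compl hA hhg
  have splith := integral_add_compl hA hint
  have hdef : ∫ u in A, (1 - h u) ∂μ = μ.real A - ∫ u in A, h u ∂μ := by
    rw [integral_sub hone hint.integrableOn]
    simp
  have hcompl_nonneg : 0 ≤ ∫ u in Aᶜ, h u * g u ∂μ :=
    integral_nonneg fun u => mul_nonneg (h0 u) (hgbd u).1
  have hcompl_le : ∫ u in Aᶜ, h u * g u ∂μ ≤ ∫ u in Aᶜ, h u ∂μ :=
    integral_mono hhg.integrableOn hint.integrableOn fun u =>
      mul_le_of_le_one_right (h0 u) (hgbd u).2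
  have hA_le : ∫ u in A, h u * g u ∂μ ≤ ∫ u in A, g u ∂μ :=
    integral_mono hhg.integrableOn hgA fun u => mul_le_of_le_one_left (hgbd u).1 (h1 u)
  have hA_ge : ∫ u in A, (g u - h u * g u) ∂μ ≤ ∫ u in A, (1 - h u) ∂μ :=
    integral_mono (hgA.sub hhg.integrableOn) (hone.sub hint.integrableOn) fun u => by
      nlinarith [h1 u, (hgbd u).2]
  rw [integral_sub hgA hhg.integrableOn] at hA_ge
  rw [abs_le]
  constructor <;> linarith

theorem stmt16 (A : Set ℝ) (hA : MeasurableSet A) (hAfin : MeasureTheory.volume A < ⊤)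
    (y : ℝ) (hy : 0 < y)
    (g : ℝ → ℝ) (hgmeas : Measurable g) (hgbd : ∀ t, g t ∈ Set.Icc (0 : ℝ) 1) :
    |(∫ u : ℝ, harmMeas (u + y * Complex.I) A * g u) - ∫ u in A, g u| ≤
      ∫ t in A, harmMeas (t + y * Complex.I) Aᶜ := by
  lift y to NNReal using hy.le
  replace hy : y ≠ 0 := (NNReal.coe_pos.mp hy).ne'
  simp_rw [harmMeas_compl _ hy hA]
  refine abs_integral_mul_sub_setIntegral_le hA hAfin (integrable_harmMeas y hA hAfin)
    (fun u => harmMeas_nonneg_s16 u hy A) (fun u => ?_) (integral_harmMeas hy hA hAfin) hgmeas hgbd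
  linarith [harmMeas_nonneg_s16 u hy Aᶜ, harmMeas_compl u hy hA]
end
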